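/- arXiv:0910.5879 — 3 statements merged into one kernel-verified Lean document; each statement's English description precedes it below -/
import Mathlib

section
/- Let m ≥ 2, p ∈ [1, m) and p* := mp/(m−p). Let Ω ⊂ ℝ^m be a bounded measurable set and let (g_k) be a sequence of Lipschitz functions g_k : ℝ^m → ℝ, each with compact support contained in Ω. If the sequences (|g_k|^p) and (|Dg_k|^p) are both equi-integrable with respect to Lebesgue measure (where Dg_k denotes the derivative of g_k, defined Lebesgue-almost everywhere by Rademacher's theorem), then the sequence (|g_k|^{p*}) is equi-integrable. -/
open MeasureTheory Filter

/-- A sequence of functions `F k` is equi-integrable (uniformly integrable) with respect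
to a measure `μ` if for every `ε > 0` there is `δ > 0` such that `∫_E |F k| ≤ ε` for
every `k` and every measurable set `E` with `μ E ≤ δ`. -/
def EquiIntegrableSeq {α : Type*} [MeasurableSpace α] (μ : Measure α)
    (F : ℕ → α → ℝ) : Prop :=
  ∀ ε : ℝ, 0 < ε → ∃ δ : ℝ, 0 < δ ∧
    ∀ E : Set α, MeasurableSet E → μ E ≤ ENNReal.ofReal δ →
      ∀ k, ∫ x in E, |F k x| ∂μ ≤ ε

open scoped Topology ENNReal NNReal Convolution

section aux
variable {m : ℕ}

local notation "V" => EuclideanSpace ℝ (Fin m)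

lemma fderiv_conv_aux (φ : ContDiffBump (0 : EuclideanSpace ℝ (Fin m)))
    {h : EuclideanSpace ℝ (Fin m) → ℝ} {K : ℝ≥0} (hK : LipschitzWith K h)
    (x : EuclideanSpace ℝ (Fin m)) :
    HasFDerivAt (φ.normed volume ⋆[ContinuousLinearMap.lsmul ℝ ℝ, volume] h)
      ((φ.normed volume ⋆[ContinuousLinearMap.lsmul ℝ ℝ, volume] (fderiv ℝ h)) x) x := by
  have hφi : Integrable (φ.normed volume) (volume : Measure (EuclideanSpace ℝ (Fin m))) :=
    φ.integrable_normed
  have hφc : Continuous (φ.normed volume) := φ.continuous_normed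
  have key := hasFDerivAt_integral_of_dominated_loc_of_lip (𝕜 := ℝ) (μ := (volume : Measure V))
    (F := fun x t => φ.normed volume t • h (x - t))
    (F' := fun t => φ.normed volume t • fderiv ℝ h (x - t)) (x₀ := x) (s := Set.univ)
    (bound := fun t => φ.normed volume t * K) Filter.univ_mem ?_ ?_ ?_ ?_ ?_ ?_
  · exact key.2
  · refine Filter.Eventually.of_forall fun y => ?_
    exact (hφc.smul (hK.continuous.comp (by fun_prop))).aestronglyMeasurable
  · apply Continuous.integrable_of_hasCompactSupport
    · exact (hφc.smul (hK.continuous.comp (by fun_prop)))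
    · exact φ.hasCompactSupport_normed.smul_right
  · refine hφc.aestronglyMeasurable.smul ?_
    have : Measurable fun t => fderiv ℝ h (x - t) :=
      (measurable_fderiv ℝ h).comp (by fun_prop)
    exact this.aestronglyMeasurable
  · refine Filter.Eventually.of_forall fun t => ?_
    apply LipschitzWith.lipschitzOnWith
    apply LipschitzWith.of_dist_le_mul
    intro a b
    have h1 := hK.dist_le_mul (a - t) (b - t)
    have h0 := φ.nonneg_normed (μ := volume) t
    simp only [dist_eq_norm, sub_sub_sub_cancel_right] at h1 ⊢
    rw [← smul_sub, norm_smul, Real.norm_of_nonneg h0]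
    have : ((Real.nnabs (φ.normed volume t * K) : ℝ≥0) : ℝ) = φ.normed volume t * K := by
      simp [abs_of_nonneg h0]
    rw [this, mul_assoc]
    gcongr
  · exact hφi.mul_const _
  · have h1 : ∀ᵐ y ∂(volume : Measure V), DifferentiableAt ℝ h y := hK.ae_differentiableAt
    have h2 : ∀ᵐ t ∂(volume : Measure V), DifferentiableAt ℝ h (x - t) :=
      (Measure.measurePreserving_sub_left (volume : Measure V) x).quasiMeasurePreserving.ae h1
    filter_upwards [h2] with t ht
    have : HasFDerivAt (fun y => h (y - t)) (fderiv ℝ h (x - t)) x := by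
      have := ht.hasFDerivAt.comp x ((hasFDerivAt_id x).sub_const t)
      rw [ContinuousLinearMap.comp_id] at this
      exact this
    exact this.fun_const_smul _

lemma norm_conv_le_aux (φ : ContDiffBump (0 : EuclideanSpace ℝ (Fin m)))
    {h : EuclideanSpace ℝ (Fin m) → ℝ} {K : ℝ≥0} (hK : LipschitzWith K h)
    (x : EuclideanSpace ℝ (Fin m)) :
    ‖(φ.normed volume ⋆[ContinuousLinearMap.lsmul ℝ ℝ, volume] (fderiv ℝ h)) x‖ ≤ K := by
  have hφi : Integrable (φ.normed volume) (volume : Measure (EuclideanSpace ℝ (Fin m))) :=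
    φ.integrable_normed
  calc _ ≤ ∫ t, φ.normed volume t * K := by
        apply norm_integral_le_of_norm_le (hφi.mul_const _)
        refine Filter.Eventually.of_forall fun t => ?_
        have h0 := φ.nonneg_normed (μ := volume) t
        simp only [ContinuousLinearMap.lsmul_apply, norm_smul, Real.norm_of_nonneg h0]
        gcongr
        exact norm_fderiv_le_of_lipschitz ℝ hK
    _ = K := by
        rw [integral_mul_const, φ.integral_normed, one_mul]

lemma lipschitz_sobolev {p q : ℝ≥0} (hm : 0 < m) (hp : 1 ≤ p)
    (hq : (q : ℝ)⁻¹ = (p : ℝ)⁻¹ - (m : ℝ)⁻¹)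
    {h : EuclideanSpace ℝ (Fin m) → ℝ} {K : ℝ≥0} (hK : LipschitzWith K h)
    (hc : HasCompactSupport h) :
    eLpNorm h q volume ≤
      SNormLESNormFDerivOfEqConst ℝ (volume : Measure (EuclideanSpace ℝ (Fin m))) p *
        eLpNorm (fderiv ℝ h) p volume := by
  set C := SNormLESNormFDerivOfEqConst ℝ (volume : Measure (EuclideanSpace ℝ (Fin m))) p
  let φ : ℕ → ContDiffBump (0 : V) := fun n =>
    { rIn := 1 / ((n : ℝ) + 1) / 2
      rOut := 1 / ((n : ℝ) + 1)
      rIn_pos := by positivity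
      rIn_lt_rOut := half_lt_self (by positivity) }
  have hφ : Tendsto (fun n => (φ n).rOut) atTop (𝓝 0) := tendsto_one_div_add_atTop_nhds_zero_nat
  have hφ1 : ∀ n, (φ n).rOut ≤ 1 := fun n => by
    change 1 / ((n : ℝ) + 1) ≤ 1
    rw [div_le_one (by positivity)]
    linarith [(Nat.cast_nonneg n : (0:ℝ) ≤ n)]
  let u : ℕ → V → ℝ := fun n =>
    ((φ n).normed volume ⋆[ContinuousLinearMap.lsmul ℝ ℝ, volume] h)
  have hfd : ∀ n, fderiv ℝ (u n) =
      ((φ n).normed volume ⋆[ContinuousLinearMap.lsmul ℝ ℝ, volume] (fderiv ℝ h)) := fun n => by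
    ext1 x
    exact (fderiv_conv_aux (φ n) hK x).fderiv
  have huC : ∀ n, ContDiff ℝ 1 (u n) := fun n =>
    HasCompactSupport.contDiff_convolution_left _ (φ n).hasCompactSupport_normed
      (φ n).contDiff_normed hK.continuous.locallyIntegrable
  have huc : ∀ n, HasCompactSupport (u n) := fun n =>
    HasCompactSupport.convolution _ (φ n).hasCompactSupport_normed hc
  have hsob : ∀ n, eLpNorm (u n) q volume ≤ C * eLpNorm (fderiv ℝ (u n)) p volume := fun n =>
    eLpNorm_le_eLpNorm_fderiv_of_eq volume (huC n) (huc n) hp (by simpa using hm) (by simpa using hq)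
  have hlim : ∀ᵐ x ∂(volume : Measure V), Tendsto (fun n => u n x) atTop (𝓝 (h x)) :=
    Filter.Eventually.of_forall fun x =>
      ContDiffBump.convolution_tendsto_right_of_continuous hφ hK.continuous x
  have hloc : LocallyIntegrable (fderiv ℝ h) (volume : Measure V) := by
    have : LocallyIntegrable (fun _ : V => (K : ℝ)) (volume : Measure V) :=
      continuous_const.locallyIntegrable
    refine this.mono (measurable_fderiv ℝ h).aestronglyMeasurable ?_
    refine Filter.Eventually.of_forall fun x => ?_
    simpa using norm_fderiv_le_of_lipschitz ℝ hK
  have hdlim : ∀ᵐ x ∂(volume : Measure V),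
      Tendsto (fun n => fderiv ℝ (u n) x) atTop (𝓝 (fderiv ℝ h x)) := by
    simp_rw [hfd]
    refine ContDiffBump.ae_convolution_tendsto_right_of_locallyIntegrable (K := 2) hφ ?_ hloc
    refine Filter.Eventually.of_forall fun n => ?_
    change 1 / ((n : ℝ) + 1) ≤ 2 * (1 / ((n : ℝ) + 1) / 2)
    linarith
  have hp0 : (0 : ℝ) < p := lt_of_lt_of_le one_pos (by exact_mod_cast hp)
  have hp0' : (p : ℝ≥0∞) ≠ 0 := by
    have : p ≠ 0 := by rintro rfl; simp at hp0
    exact_mod_cast this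
  -- support of the derivatives in a fixed ball
  obtain ⟨R, hR⟩ := hc.isCompact.isBounded.subset_closedBall (0 : V)
  have hsupp : ∀ n x, x ∉ Metric.closedBall (0 : V) (R + 1) → fderiv ℝ (u n) x = 0 := by
    intro n x hx
    by_contra hne
    rw [hfd n] at hne
    have := support_convolution_subset (ContinuousLinearMap.lsmul ℝ ℝ) (μ := (volume : Measure V))
      (f := (φ n).normed volume) (g := fderiv ℝ h) hne
    obtain ⟨a, ha, b, hb, hab⟩ := Set.mem_add.1 this
    rw [(φ n).support_normed_eq] at ha
    have hb' := hR (support_fderiv_subset ℝ hb)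
    apply hx
    simp only [Metric.mem_ball, Metric.mem_closedBall, dist_zero_right] at ha hb' ⊢
    rw [← hab]
    linarith [norm_add_le a b, hφ1 n]
  have hconv : Tendsto (fun n => eLpNorm (fderiv ℝ (u n)) p volume) atTop
      (𝓝 (eLpNorm (fderiv ℝ h) p volume)) := by
    simp_rw [eLpNorm_eq_lintegral_rpow_enorm_toReal hp0' ENNReal.coe_ne_top]
    refine (ENNReal.continuous_rpow_const.tendsto _).comp ?_
    refine tendsto_lintegral_of_dominated_convergence
      ((Metric.closedBall (0 : V) (R + 1)).indicator fun _ => (K : ℝ≥0∞) ^ (p : ℝ)) ?_ ?_ ?_ ?_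
    · intro n
      exact (measurable_fderiv ℝ (u n)).enorm.pow_const _
    · intro n
      refine Filter.Eventually.of_forall fun x => ?_
      by_cases hx : x ∈ Metric.closedBall (0 : V) (R + 1)
      · rw [Set.indicator_of_mem hx]
        simp only [ENNReal.coe_toReal]
        gcongr
        rw [hfd n]
        have := norm_conv_le_aux (φ n) hK x
        rw [enorm_eq_nnnorm]
        exact_mod_cast this
      · rw [Set.indicator_of_notMem hx]
        dsimp only
        have h0 : ‖fderiv ℝ (u n) x‖ₑ = 0 := by
          rw [hsupp n x hx]
          exact enorm_zero (E := EuclideanSpace ℝ (Fin m) →L[ℝ] ℝ)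
        rw [h0]
        simp [hp0]
    · rw [lintegral_indicator_const Metric.isClosed_closedBall.measurableSet]
      refine ENNReal.mul_ne_top ?_ measure_closedBall_lt_top.ne
      exact ENNReal.rpow_ne_top_of_nonneg hp0.le ENNReal.coe_ne_top
    · filter_upwards [hdlim] with x hx
      exact (ENNReal.continuous_rpow_const.tendsto _).comp hx.enorm
  calc eLpNorm h q volume ≤ liminf (fun n => eLpNorm (u n) q volume) atTop :=
        Lp.eLpNorm_lim_le_liminf_eLpNorm (fun n => (huC n).continuous.aestronglyMeasurable) h hlim
    _ ≤ liminf (fun n => C * eLpNorm (fderiv ℝ (u n)) p volume) atTop :=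
        liminf_le_liminf (Filter.Eventually.of_forall hsob)
    _ = _ := (ENNReal.Tendsto.const_mul hconv (Or.inr ENNReal.coe_ne_top)).liminf_eq

end aux

section aux2
variable {m : ℕ}

local notation "V" => EuclideanSpace ℝ (Fin m)

lemma equi_iff_aux {G : Type*} [NormedAddCommGroup G] {f : ℕ → EuclideanSpace ℝ (Fin m) → G}
    {p : ℝ} (hp : 0 < p)
    (hf : ∀ k, Integrable (fun x => ‖f k x‖ ^ p) volume) :
    EquiIntegrableSeq volume (fun k x => ‖f k x‖ ^ p) ↔
      ∀ ε : ℝ, 0 < ε → ∃ δ : ℝ, 0 < δ ∧ ∀ E : Set (EuclideanSpace ℝ (Fin m)), MeasurableSet E →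
        volume E ≤ ENNReal.ofReal δ → ∀ k, ∫⁻ x in E, ‖f k x‖ₑ ^ p ≤ ENNReal.ofReal ε := by
  have key : ∀ (E : Set (EuclideanSpace ℝ (Fin m))) (k : ℕ) (ε : ℝ), 0 < ε →
      ((∫ x in E, |‖f k x‖ ^ p|) ≤ ε ↔ ∫⁻ x in E, ‖f k x‖ₑ ^ p ≤ ENNReal.ofReal ε) := by
    intro E k ε hε
    have h1 : (∫⁻ x in E, ‖f k x‖ₑ ^ p) = ENNReal.ofReal (∫ x in E, |‖f k x‖ ^ p|) := by
      rw [ofReal_integral_eq_lintegral_ofReal (hf k).abs.integrableOn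
        (Filter.Eventually.of_forall fun x => abs_nonneg _)]
      refine lintegral_congr fun x => ?_
      rw [abs_of_nonneg (by positivity), ← ENNReal.ofReal_rpow_of_nonneg (norm_nonneg _) hp.le,
        ofReal_norm]
    rw [h1, ENNReal.ofReal_le_ofReal_iff hε.le]
  unfold EquiIntegrableSeq
  refine forall₂_congr fun ε hε => ?_
  simp only [key _ _ ε hε]

lemma trunc_fderiv_aux {g : EuclideanSpace ℝ (Fin m) → ℝ} (hg : Continuous g) {M : ℝ} (hM : 0 < M)
    (x : EuclideanSpace ℝ (Fin m)) :
    ‖fderiv ℝ (fun y => max (|g y| - M) 0) x‖ ≤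
      ‖({y | M ≤ |g y|}.indicator (fderiv ℝ g)) x‖ := by
  by_cases hx : M < |g x|
  · rw [Set.indicator_of_mem (by exact hx.le)]
    rcases lt_abs.1 hx with h | h
    · have : (fun y => max (|g y| - M) 0) =ᶠ[𝓝 x] fun y => g y - M := by
        filter_upwards [hg.continuousAt.eventually_const_lt h] with y hy
        rw [abs_of_pos (hM.trans hy), max_eq_left (by linarith)]
      rw [this.fderiv_eq, fderiv_sub_const]
    · have : (fun y => max (|g y| - M) 0) =ᶠ[𝓝 x] fun y => -g y - M := by
        filter_upwards [hg.neg.continuousAt.eventually_const_lt h] with y hy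
        have hy : M < - g y := hy
        rw [abs_of_neg (by linarith), max_eq_left (by linarith)]
      rw [this.fderiv_eq, fderiv_sub_const, fderiv_fun_neg, norm_neg]
  · have : IsLocalMin (fun y => max (|g y| - M) 0) x := by
      refine Filter.Eventually.of_forall fun y => ?_
      dsimp only
      rw [max_eq_right (by linarith : |g x| - M ≤ 0)]
      exact le_max_right _ _
    rw [this.fderiv_eq_zero, norm_zero]
    positivity

lemma trunc_lip_aux {g : EuclideanSpace ℝ (Fin m) → ℝ} {K : ℝ≥0} (hg : LipschitzWith K g) (M : ℝ) :
    LipschitzWith K (fun y => max (|g y| - M) 0) := by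
  apply LipschitzWith.of_dist_le_mul
  intro a b
  have := hg.dist_le_mul a b
  refine le_trans ?_ this
  rw [Real.dist_eq, Real.dist_eq]
  calc _ ≤ |(|g a| - M) - (|g b| - M)| := abs_max_sub_max_le_abs _ _ _
    _ = |(|g a| - |g b|)| := by congr 1; ring
    _ ≤ _ := abs_abs_sub_abs_le _ _

lemma bound_aux {Ω : Set (EuclideanSpace ℝ (Fin m))} (hm : 0 < m) (hΩ : Bornology.IsBounded Ω)
    {f : ℕ → EuclideanSpace ℝ (Fin m) → ℝ≥0∞} (hf : ∀ k, Function.support (f k) ⊆ Ω)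
    {δ : ℝ} (hδ : 0 < δ)
    (h : ∀ E : Set (EuclideanSpace ℝ (Fin m)), MeasurableSet E →
        volume E ≤ ENNReal.ofReal δ → ∀ k, ∫⁻ x in E, f k x ≤ 1) :
    ∃ N : ℕ, ∀ k, ∫⁻ x, f k x ≤ N := by
  have : Nonempty (Fin m) := ⟨⟨0, hm⟩⟩
  obtain ⟨r, hr, hrδ⟩ : ∃ r : ℝ, 0 < r ∧
      ∀ x : V, volume (Metric.ball x r) ≤ ENNReal.ofReal δ := by
    have h1 : Tendsto (fun r : ℝ => volume (Metric.closedBall (0 : V) r)) (𝓝[>] 0) (𝓝 0) := by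
      have := tendsto_measure_cthickening_of_isClosed (μ := (volume : Measure V)) (s := {0})
        ⟨1, one_pos, ?_⟩ isClosed_singleton
      · rw [measure_singleton] at this
        refine (this.mono_left nhdsWithin_le_nhds).congr' ?_
        filter_upwards [self_mem_nhdsWithin] with r hr
        rw [Metric.cthickening_singleton _ (le_of_lt hr)]
      · rw [Metric.cthickening_singleton _ zero_le_one]
        exact measure_closedBall_lt_top.ne
    have h2 := (h1.eventually_lt_const (ENNReal.ofReal_pos.2 hδ)).and self_mem_nhdsWithin
    obtain ⟨r, hr1, hr2⟩ := h2.exists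
    refine ⟨r, hr2, fun x => ?_⟩
    rw [Measure.addHaar_ball_center]
    exact (measure_mono Metric.ball_subset_closedBall).trans hr1.le
  obtain ⟨t, ht, hcov⟩ := Metric.totallyBounded_iff.1 (hΩ.isCompact_closure.totallyBounded.subset
    subset_closure) r hr
  have := ht.fintype
  refine ⟨Fintype.card t, fun k => ?_⟩
  calc ∫⁻ x, f k x = ∫⁻ x in ⋃ i : t, Metric.ball (i : V) r, f k x := by
        rw [setLIntegral_eq_of_support_subset]
        rw [← Set.biUnion_eq_iUnion t (fun i _ => Metric.ball i r)]
        exact (hf k).trans hcov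
    _ ≤ ∑' i : t, ∫⁻ x in Metric.ball (i : V) r, f k x := lintegral_iUnion_le _ _
    _ = ∑ i : t, ∫⁻ x in Metric.ball (i : V) r, f k x := tsum_fintype _
    _ ≤ ∑ i : t, 1 := Finset.sum_le_sum fun i _ => h _ measurableSet_ball (hrδ _) k
    _ = _ := by simp

end aux2

/-- Let `m ≥ 2`, `p ∈ [1, m)` and `p* = mp/(m−p)`. Let `Ω ⊆ ℝ^m` be bounded and
measurable, and let `(g_k)` be Lipschitz functions with compact support contained in
`Ω`. If `(|g_k|^p)` and `(|Dg_k|^p)` are equi-integrable for Lebesgue measure, then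
`(|g_k|^{p*})` is equi-integrable. -/
theorem equiintegrable_pstar_of_equiintegrable
    {m : ℕ} (hm : 2 ≤ m) (p : ℝ) (hp1 : 1 ≤ p) (hpm : p < m)
    (Ω : Set (EuclideanSpace ℝ (Fin m))) (hΩbd : Bornology.IsBounded Ω)
    (hΩmeas : MeasurableSet Ω)
    (g : ℕ → EuclideanSpace ℝ (Fin m) → ℝ)
    (hlip : ∀ k, ∃ K : NNReal, LipschitzWith K (g k))
    (hsupp : ∀ k, HasCompactSupport (g k) ∧ tsupport (g k) ⊆ Ω)
    (hgequi : EquiIntegrableSeq volume (fun k x => |g k x| ^ p))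
    (hDgequi : EquiIntegrableSeq volume (fun k x => ‖fderiv ℝ (g k) x‖ ^ p)) :
    EquiIntegrableSeq volume (fun k x => |g k x| ^ (m * p / (m - p))) := by
  have hm0 : 0 < m := by omega
  have hp0 : 0 < p := by linarith
  have hmR : (0 : ℝ) < m := by exact_mod_cast hm0
  have hmp : 0 < (m : ℝ) - p := by linarith
  obtain ⟨q, hq⟩ : ∃ q : ℝ, q = m * p / (m - p) := ⟨_, rfl⟩
  rw [← hq]
  have hq0 : 0 < q := by rw [hq]; positivity
  have hqinv : q⁻¹ = p⁻¹ - (m : ℝ)⁻¹ := by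
    rw [hq]; field_simp
  clear hq
  have hint : ∀ r : ℝ, 0 < r → ∀ k, Integrable (fun x => ‖g k x‖ ^ r) volume := by
    intro r hr k
    obtain ⟨K, hK⟩ := hlip k
    apply Continuous.integrable_of_hasCompactSupport
    · exact hK.continuous.norm.rpow_const fun x => Or.inr hr.le
    · exact (hsupp k).1.comp_left (g := fun y : ℝ => ‖y‖ ^ r) (by simp [hr.ne'])
  have hintD : ∀ k, Integrable (fun x => ‖fderiv ℝ (g k) x‖ ^ p) volume := by
    intro k
    obtain ⟨K, hK⟩ := hlip k
    have hs : Function.support (fun x => ‖fderiv ℝ (g k) x‖ ^ p) ⊆ tsupport (g k) := by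
      intro x hx
      apply support_fderiv_subset ℝ
      intro h0
      apply hx
      simp [h0, hp0.ne']
    rw [← integrableOn_iff_integrable_of_support_subset hs]
    refine Measure.integrableOn_of_bounded (M := (K : ℝ) ^ p) (hsupp k).1.isCompact.measure_lt_top.ne
      ?_ ?_
    · exact ((measurable_fderiv ℝ (g k)).norm.pow_const p).aestronglyMeasurable
    · refine Filter.Eventually.of_forall fun x => ?_
      rw [Real.norm_of_nonneg (by positivity)]
      gcongr
      exact norm_fderiv_le_of_lipschitz ℝ hK
  have hG := (equi_iff_aux hp0 (hint p hp0)).1 hgequi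
  have hD := (equi_iff_aux hp0 hintD).1 hDgequi
  refine (equi_iff_aux hq0 (hint q hq0)).2 ?_
  obtain ⟨δ₁, hδ₁, hG1⟩ := hG 1 one_pos
  obtain ⟨N, hN⟩ := bound_aux (f := fun k x => ‖g k x‖ₑ ^ p) hm0 hΩbd (fun k => by
    refine Set.Subset.trans ?_ (hsupp k).2
    intro x hx
    apply subset_tsupport
    intro h0
    apply hx
    simp [h0, hp0]) hδ₁ (by simpa using hG1)
  lift p to ℝ≥0 using hp0.le
  lift q to ℝ≥0 using hq0.le
  have hpE : (p : ℝ≥0∞) ≠ 0 := by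
    have : p ≠ 0 := by rintro rfl; simp at hp0
    exact_mod_cast this
  have hqE : (q : ℝ≥0∞) ≠ 0 := by
    have : q ≠ 0 := by rintro rfl; simp at hq0
    exact_mod_cast this
  have hq1 : (1 : ℝ≥0∞) ≤ q := by
    have h1 : (q : ℝ)⁻¹ ≤ 1 := by
      rw [hqinv]
      have : (p : ℝ)⁻¹ ≤ 1 := inv_le_one_of_one_le₀ hp1
      have : (0 : ℝ) < (m : ℝ)⁻¹ := by positivity
      linarith
    have h2 : (1 : ℝ) ≤ q := by
      rwa [inv_le_one₀ hq0] at h1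
    exact_mod_cast h2
  set C : ℝ≥0 := SNormLESNormFDerivOfEqConst ℝ (volume : Measure (EuclideanSpace ℝ (Fin m))) p
  intro ε hε
  obtain ⟨e, he⟩ : ∃ e : ℝ, e = ε ^ (1 / (q : ℝ)) := ⟨_, rfl⟩
  have he0 : 0 < e := by rw [he]; positivity
  have heq : e ^ (q : ℝ) = ε := by
    rw [he, ← Real.rpow_mul hε.le, one_div_mul_cancel hq0.ne', Real.rpow_one]
  obtain ⟨t, ht⟩ : ∃ t : ℝ, t = e / 2 / (C + 1) := ⟨_, rfl⟩
  have ht0 : 0 < t := by rw [ht]; positivity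
  have hCt : C * t ≤ e / 2 := by
    have h1 : (C + 1) * t = e / 2 := by rw [ht]; field_simp
    nlinarith
  obtain ⟨δ₂, hδ₂, hD2⟩ := hD (t ^ (p : ℝ)) (by positivity)
  obtain ⟨M, hM⟩ : ∃ M : ℝ, M = (N / δ₂ + 1) ^ (1 / (p : ℝ)) := ⟨_, rfl⟩
  have hM0 : 0 < M := by rw [hM]; positivity
  have hMp : M ^ (p : ℝ) = N / δ₂ + 1 := by
    rw [hM, ← Real.rpow_mul (by positivity), one_div_mul_cancel hp0.ne', Real.rpow_one]
  refine ⟨(e / 2 / M) ^ (q : ℝ), by positivity, fun E hE hvol k => ?_⟩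
  obtain ⟨K, hK⟩ := hlip k
  have hS : MeasurableSet {y | M ≤ |g k y|} :=
    measurableSet_le measurable_const hK.continuous.abs.measurable
  have hvolS : volume {y | M ≤ |g k y|} ≤ ENNReal.ofReal δ₂ := by
    have h1 := mul_meas_ge_le_lintegral (μ := (volume : Measure (EuclideanSpace ℝ (Fin m))))
      (hK.continuous.measurable.enorm.pow_const (p : ℝ)) (ENNReal.ofReal (M ^ (p : ℝ)))
    have h2 : {y | M ≤ |g k y|} ⊆ {y | ENNReal.ofReal (M ^ (p : ℝ)) ≤ ‖g k y‖ₑ ^ (p : ℝ)} := by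
      intro y hy
      have hy : M ≤ |g k y| := hy
      simp only [Set.mem_ofPred_eq]
      rw [← ENNReal.ofReal_rpow_of_pos hM0, ← ofReal_norm, Real.norm_eq_abs]
      gcongr
    have h3 : ENNReal.ofReal (M ^ (p : ℝ)) * volume {y | M ≤ |g k y|} ≤ N :=
      (mul_le_mul_right (measure_mono h2) _).trans (h1.trans (hN k))
    have h4 : (N : ℝ≥0∞) ≤ ENNReal.ofReal (M ^ (p : ℝ)) * ENNReal.ofReal δ₂ := by
      rw [← ENNReal.ofReal_mul (by positivity), ← ENNReal.ofReal_natCast, hMp]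
      apply ENNReal.ofReal_le_ofReal
      have : ((N : ℝ) / δ₂ + 1) * δ₂ = N + δ₂ := by field_simp
      linarith
    refine (ENNReal.mul_le_mul_iff_right ?_ ENNReal.ofReal_ne_top).1 (h3.trans h4)
    exact (ENNReal.ofReal_pos.2 (by positivity)).ne'
  have hDS : eLpNorm ({y | M ≤ |g k y|}.indicator (fderiv ℝ (g k))) p volume
      ≤ ENNReal.ofReal t := by
    refine (eLpNorm_indicator_eq_eLpNorm_restrict (f := fderiv ℝ (g k)) hS).le.trans ?_
    rw [eLpNorm_eq_lintegral_rpow_enorm_toReal hpE ENNReal.coe_ne_top, ENNReal.coe_toReal]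
    calc _ ≤ (ENNReal.ofReal (t ^ (p : ℝ))) ^ (1 / (p : ℝ)) := by
          gcongr
          exact hD2 _ hS hvolS k
      _ = _ := by
          rw [ENNReal.ofReal_rpow_of_pos (by positivity), ← Real.rpow_mul ht0.le,
            mul_one_div_cancel hp0.ne', Real.rpow_one]
  have hsob := lipschitz_sobolev (p := p) (q := q) hm0 (by exact_mod_cast hp1) hqinv
    (trunc_lip_aux hK M)
    ((hsupp k).1.comp_left (g := fun y : ℝ => max (|y| - M) 0) (by simp [hM0.le]))
  have hh : eLpNorm (fun y => max (|g k y| - M) 0) q volume ≤ ENNReal.ofReal (e / 2) := by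
    calc _ ≤ (C : ℝ≥0∞) * eLpNorm (fderiv ℝ (fun y => max (|g k y| - M) 0)) p volume := hsob
      _ ≤ C * ENNReal.ofReal t := by
          gcongr
          exact (eLpNorm_mono (trunc_fderiv_aux hK.continuous hM0)).trans hDS
      _ = ENNReal.ofReal (C * t) := by
          rw [ENNReal.ofReal_mul C.coe_nonneg, ENNReal.ofReal_coe_nnreal]
      _ ≤ _ := ENNReal.ofReal_le_ofReal hCt
  have hconst : eLpNorm (fun _ : EuclideanSpace ℝ (Fin m) => M) q (volume.restrict E)
      ≤ ENNReal.ofReal (e / 2) := by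
    rw [eLpNorm_const' _ hqE ENNReal.coe_ne_top, Measure.restrict_apply_univ, ENNReal.coe_toReal]
    calc _ ≤ ENNReal.ofReal M * (ENNReal.ofReal ((e / 2 / M) ^ (q : ℝ))) ^ (1 / (q : ℝ)) := by
          rw [← ofReal_norm, Real.norm_of_nonneg hM0.le]
          gcongr
      _ = ENNReal.ofReal (e / 2) := by
          rw [ENNReal.ofReal_rpow_of_pos (by positivity), ← Real.rpow_mul (by positivity),
            mul_one_div_cancel hq0.ne', Real.rpow_one, ← ENNReal.ofReal_mul hM0.le]
          congr 1
          field_simp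
  have hfin : eLpNorm (g k) q (volume.restrict E) ≤ ENNReal.ofReal e := by
    calc eLpNorm (g k) q (volume.restrict E)
        ≤ eLpNorm ((fun y => max (|g k y| - M) 0) + fun _ => M) q (volume.restrict E) := by
          refine eLpNorm_mono fun x => ?_
          simp only [Pi.add_apply]
          rw [Real.norm_eq_abs, Real.norm_of_nonneg (by positivity)]
          linarith [le_max_left (|g k x| - M) 0]
      _ ≤ eLpNorm (fun y => max (|g k y| - M) 0) q (volume.restrict E)
          + eLpNorm (fun _ => M) q (volume.restrict E) :=
          eLpNorm_add_le (trunc_lip_aux hK M).continuous.aestronglyMeasurable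
            aestronglyMeasurable_const hq1
      _ ≤ ENNReal.ofReal (e / 2) + ENNReal.ofReal (e / 2) :=
          add_le_add ((eLpNorm_mono_measure _ Measure.restrict_le_self).trans hh) hconst
      _ = ENNReal.ofReal e := by
          rw [← ENNReal.ofReal_add (by positivity) (by positivity), add_halves]
  rw [eLpNorm_eq_lintegral_rpow_enorm_toReal hqE ENNReal.coe_ne_top, ENNReal.coe_toReal, one_div,
    ENNReal.rpow_inv_le_iff hq0, ENNReal.ofReal_rpow_of_pos he0, heq] at hfin
  exact hfin
end

section
/- Let m ≥ 1 and let Ω ⊂ ℝ^m be a bounded measurable set. Let (g_k) be a sequence of Lipschitz functions g_k : ℝ^m → ℝ, each with compact support contained in Ω, such that the sequences (|g_k|^m) and (|Dg_k|^m) are both equi-integrable with respect to Lebesgue measure (where Dg_k denotes the derivative of g_k, defined Lebesgue-almost everywhere by Rademacher's theorem). Then for every exponent q ∈ [1, ∞) the sequence (|g_k|^q) is equi-integrable. -/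
open MeasureTheory Filter

open scoped NNReal ENNReal Topology Convolution

theorem sob_one {u : EuclideanSpace ℝ (Fin 1) → ℝ} (hu : ContDiff ℝ 1 u) (hc : HasCompactSupport u)
    (x : EuclideanSpace ℝ (Fin 1)) : ‖u x‖ₑ ≤ ∫⁻ y, ‖fderiv ℝ u y‖ₑ := by
  let e : ℝ ≃ₗᵢ[ℝ] EuclideanSpace ℝ (Fin 1) := (OrthonormalBasis.singleton (Fin 1) ℝ).repr
  obtain ⟨t, rfl⟩ := e.surjective x
  have h1 : ContDiff ℝ 1 (u ∘ e) := hu.comp e.contDiff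
  have h2 : HasCompactSupport (u ∘ e) := hc.comp_homeomorph e.toHomeomorph
  have h3 := HasCompactSupport.enorm_le_lintegral_Ici_deriv h1 h2 t
  have h4 : ∫⁻ y, ‖fderiv ℝ u y‖ₑ = ∫⁻ s, ‖fderiv ℝ u (e s)‖ₑ :=
    (e.measurePreserving.lintegral_comp_emb e.toMeasurableEquiv.measurableEmbedding _).symm
  rw [h4]
  refine h3.trans ((setLIntegral_le_lintegral _ _).trans (lintegral_mono fun s => ?_))
  have h5 : deriv (u ∘ e) s = fderiv ℝ u (e s) (e 1) := by
    rw [← fderiv_apply_one_eq_deriv, fderiv_comp s (hu.differentiable one_ne_zero).differentiableAt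
      e.differentiableAt]
    have : fderiv ℝ e s = (e.toContinuousLinearEquiv : ℝ →L[ℝ] _) := 
      e.toContinuousLinearEquiv.fderiv
    simp [this]
  rw [h5]
  refine (ContinuousLinearMap.le_opENorm _ _).trans ?_
  have : ‖e 1‖ₑ = 1 := by rw [← ofReal_norm, e.norm_map]; simp
  rw [this, mul_one]

theorem sob_C1 {m : ℕ} (hm : 1 ≤ m) {s : Set (EuclideanSpace ℝ (Fin m))}
    (hs : Bornology.IsBounded s) (r : ℝ≥0) (hr : 2 ≤ r) :
    ∃ C : ℝ≥0∞, C ≠ ⊤ ∧ ∀ u : EuclideanSpace ℝ (Fin m) → ℝ, ContDiff ℝ 1 u →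
      Function.support u ⊆ s → eLpNorm u r volume ≤ C * eLpNorm (fderiv ℝ u) m volume := by
  have hcs : IsCompact (closure s) := hs.isCompact_closure
  have hvol : volume (closure s) ≠ ⊤ := hcs.measure_lt_top.ne
  rcases hm.eq_or_lt with rfl | hm2
  · refine ⟨volume (closure s) ^ ((r : ℝ≥0∞).toReal)⁻¹, ?_, fun u hu hus => ?_⟩
    · exact ENNReal.rpow_ne_top_of_nonneg (by positivity) hvol
    have hc : HasCompactSupport u := HasCompactSupport.of_support_subset_isCompact hcs (hus.trans subset_closure)
    rw [← eLpNorm_restrict_eq_of_support_subset (hus.trans subset_closure)]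
    have h := eLpNorm_le_of_ae_enorm_bound (μ := volume.restrict (closure s)) (p := r) 
      (ae_of_all _ (sob_one hu hc))
    rw [mul_comm]
    simpa [eLpNorm_one_eq_lintegral_enorm] using h
  · have hr0 : (0 : ℝ≥0) < r := lt_of_lt_of_le (by norm_num) hr
    have hm0 : (0 : ℝ≥0) < m := by exact_mod_cast hm
    set p : ℝ≥0 := ((m : ℝ≥0)⁻¹ + r⁻¹)⁻¹ with hp
    have hpm : p < m := by
      rw [hp]
      apply inv_lt_of_inv_lt₀ hm0
      exact lt_add_of_pos_right _ (by positivity)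
    have hp1 : 1 ≤ p := by
      rw [hp, one_le_inv₀ (by positivity)]
      have a1 : (m : ℝ≥0)⁻¹ ≤ 2⁻¹ := by gcongr; exact_mod_cast hm2
      have a2 : r⁻¹ ≤ 2⁻¹ := by gcongr
      calc _ ≤ (2⁻¹ + 2⁻¹ : ℝ≥0) := add_le_add a1 a2
        _ = 1 := by rw [← two_mul, mul_inv_cancel₀ two_ne_zero]
    refine ⟨eLpNormLESNormFDerivOfLeConst ℝ (volume : Measure (EuclideanSpace ℝ (Fin m))) s p r * volume (closure s) ^ (1 / (p : ℝ≥0∞).toReal - 1 / (m : ℝ≥0∞).toReal), ?_, fun u hu hus => ?_⟩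
    · refine ENNReal.mul_ne_top (by simp) (ENNReal.rpow_ne_top_of_nonneg ?_ hvol)
      simp only [ENNReal.coe_toReal, ENNReal.toReal_natCast, one_div, sub_nonneg]
      rw [hp]; push_cast; rw [inv_inv]; simp
    have h1 := eLpNorm_le_eLpNorm_fderiv_of_le (volume : Measure (EuclideanSpace ℝ (Fin m))) hu hus
      (p := p) (q := r) hp1 (by simpa using hpm) (by rw [hp]; simp) hs
    have hsub : Function.support (fderiv ℝ u) ⊆ closure s :=
      (support_fderiv_subset ℝ).trans (closure_mono hus)
    have h2 := eLpNorm_le_eLpNorm_mul_rpow_measure_univ (μ := volume.restrict (closure s))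
      (p := p) (q := m) (f := fderiv ℝ u) (by exact_mod_cast hpm.le)
      ((hu.continuous_fderiv one_ne_zero).aestronglyMeasurable)
    have hk : ∀ q : ℝ≥0∞, eLpNorm (fderiv ℝ u) q (volume.restrict (closure s)) =
        eLpNorm (fderiv ℝ u) q volume := fun q =>
      eLpNorm_restrict_eq_of_support_subset (f := fderiv ℝ u) (by exact hsub)
    rw [hk, hk, Measure.restrict_apply_univ] at h2
    calc _ ≤ _ := h1
      _ ≤ _ := mul_le_mul_right h2 _
      _ = _ := by ring

theorem fderiv_conv {m : ℕ} {K : ℝ≥0} {g : EuclideanSpace ℝ (Fin m) → ℝ} (hg : LipschitzWith K g)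
    {φ : EuclideanSpace ℝ (Fin m) → ℝ} (hφ : Continuous φ) (hφc : HasCompactSupport φ)
    (x : EuclideanSpace ℝ (Fin m)) :
    fderiv ℝ (φ ⋆[ContinuousLinearMap.lsmul ℝ ℝ, volume] g) x =
      (φ ⋆[ContinuousLinearMap.lsmul ℝ ℝ, volume] (fderiv ℝ g)) x := by
  have hφi : Integrable φ := hφ.integrable_of_hasCompactSupport hφc
  have := hasFDerivAt_integral_of_dominated_loc_of_lip (𝕜 := ℝ) (μ := (volume : Measure (EuclideanSpace ℝ (Fin m))))
    (F := fun x t => φ t * g (x - t)) (F' := fun t => φ t • fderiv ℝ g (x - t)) (s := Set.univ)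
    (x₀ := x) (bound := fun t => φ t * K) univ_mem ?_ ?_ ?_ ?_ ?_ ?_
  · exact this.2.fderiv
  · refine Eventually.of_forall fun y => Continuous.aestronglyMeasurable ?_
    have := hg.continuous
    fun_prop
  · refine Continuous.integrable_of_hasCompactSupport ?_ hφc.mul_right
    have := hg.continuous
    fun_prop
  · exact (hφ.measurable.smul ((measurable_fderiv ℝ g).comp (measurable_const.sub measurable_id))).aestronglyMeasurable
  · refine ae_of_all _ fun t => LipschitzOnWith.of_dist_le_mul fun y _ z _ => ?_
    rw [Real.dist_eq, ← mul_sub, abs_mul]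
    have := hg.dist_le_mul (y - t) (z - t)
    rw [dist_sub_right, Real.dist_eq] at this
    simp only [Real.coe_nnabs, abs_mul, NNReal.abs_eq, mul_assoc]
    gcongr
  · exact hφi.mul_const _
  · have h := hg.ae_differentiableAt (μ := (volume : Measure (EuclideanSpace ℝ (Fin m))))
    have h' := (Measure.measurePreserving_sub_left volume x).quasiMeasurePreserving.ae h
    filter_upwards [h'] with t ht
    have := (ht.hasFDerivAt.comp x ((hasFDerivAt_id x).sub_const t)).const_mul (φ t)
    simpa [Function.comp_def] using this

theorem sob_lip {m : ℕ} (hm : 1 ≤ m) {s : Set (EuclideanSpace ℝ (Fin m))}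
    (hs : Bornology.IsBounded s) (r : ℝ≥0) (hr : 2 ≤ r) :
    ∃ C : ℝ≥0∞, C ≠ ⊤ ∧ ∀ (g : EuclideanSpace ℝ (Fin m) → ℝ) (K : ℝ≥0), LipschitzWith K g →
      Function.support g ⊆ s → eLpNorm g r volume ≤ C * eLpNorm (fderiv ℝ g) m volume := by
  set S := Metric.cthickening 1 s with hS
  have hSb : Bornology.IsBounded S := hs.cthickening
  have hSc : IsCompact S := Metric.isCompact_of_isClosed_isBounded Metric.isClosed_cthickening hSb
  obtain ⟨C, hC, H⟩ := sob_C1 hm hSb r hr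
  refine ⟨C, hC, fun g K hg hgs => ?_⟩
  let φ : ℕ → ContDiffBump (0 : EuclideanSpace ℝ (Fin m)) := fun n =>
    ⟨1 / ((n : ℝ) + 1) / 2, 1 / ((n : ℝ) + 1), by positivity, half_lt_self (by positivity)⟩
  have hrout : ∀ n, (φ n).rOut = 1 / ((n : ℝ) + 1) := fun n => rfl
  have hrin : ∀ n, (φ n).rIn = 1 / ((n : ℝ) + 1) / 2 := fun n => rfl
  have hφ0 : Tendsto (fun n => (φ n).rOut) atTop (𝓝 0) := tendsto_one_div_add_atTop_nhds_zero_nat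
  let G : ℕ → EuclideanSpace ℝ (Fin m) → ℝ := fun n =>
    (φ n).normed volume ⋆[ContinuousLinearMap.lsmul ℝ ℝ, volume] g
  have hGC : ∀ n, ContDiff ℝ 1 (G n) := fun n =>
    HasCompactSupport.contDiff_convolution_left _ (φ n).hasCompactSupport_normed
      (φ n).contDiff_normed hg.continuous.locallyIntegrable
  have hGs : ∀ n, Function.support (G n) ⊆ S := by
    intro n
    refine (support_convolution_subset _).trans ?_
    rw [(φ n).support_normed_eq]
    rintro _ ⟨a, ha, b, hb, rfl⟩
    refine Metric.mem_cthickening_of_dist_le _ b _ _ (hgs hb) ?_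
    simp only [Metric.mem_ball, dist_zero_right] at ha
    rw [dist_eq_norm, add_sub_cancel_right]
    refine ha.le.trans ?_
    rw [hrout, div_le_one (by positivity)]
    have : (0 : ℝ) ≤ n := by positivity
    linarith
  have hGD : ∀ n, fderiv ℝ (G n) = 
      (φ n).normed volume ⋆[ContinuousLinearMap.lsmul ℝ ℝ, volume] (fderiv ℝ g) := fun n =>
    funext fun x => fderiv_conv hg (φ n).continuous_normed (φ n).hasCompactSupport_normed x
  have hDb : ∀ x, ‖fderiv ℝ g x‖ ≤ K := fun x => norm_fderiv_le_of_lipschitz ℝ hg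
  have hGb : ∀ n x, ‖fderiv ℝ (G n) x‖ ≤ K := by
    intro n x
    rw [hGD, convolution_def]
    have hi : Integrable ((φ n).normed volume) :=
      (φ n).continuous_normed.integrable_of_hasCompactSupport (φ n).hasCompactSupport_normed
    refine (norm_integral_le_of_norm_le (hi.mul_const (K : ℝ)) (ae_of_all _ fun t => ?_)).trans ?_
    · rw [ContinuousLinearMap.lsmul_apply, norm_smul, Real.norm_of_nonneg ((φ n).nonneg_normed t)]
      exact mul_le_mul_of_nonneg_left (hDb _) ((φ n).nonneg_normed t)
    · rw [integral_mul_const, (φ n).integral_normed, one_mul]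
  have hloc : LocallyIntegrable (fderiv ℝ g) := by
    refine (locallyIntegrable_const (K : ℝ)).mono
      (measurable_fderiv ℝ g).aestronglyMeasurable (ae_of_all _ fun x => ?_)
    simpa using hDb x
  have hlim : ∀ᵐ x, Tendsto (fun n => fderiv ℝ (G n) x) atTop (𝓝 (fderiv ℝ g x)) := by
    have := ContDiffBump.ae_convolution_tendsto_right_of_locallyIntegrable (K := 2) (φ := φ)
      (μ := (volume : Measure (EuclideanSpace ℝ (Fin m)))) hφ0
      (Eventually.of_forall fun n => by rw [hrout, hrin]; apply le_of_eq; ring) hloc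
    simpa only [hGD] using this
  have hm0 : (m : ℝ≥0∞) ≠ 0 := by exact_mod_cast (by omega : m ≠ 0)
  have hmt : (m : ℝ≥0∞) ≠ ⊤ := by simp
  have hT : Tendsto (fun n => eLpNorm (fderiv ℝ (G n)) m volume) atTop
      (𝓝 (eLpNorm (fderiv ℝ g) m volume)) := by
    simp only [eLpNorm_eq_lintegral_rpow_enorm_toReal hm0 hmt]
    refine ((ENNReal.continuous_rpow_const).tendsto _).comp ?_
    refine tendsto_lintegral_of_dominated_convergence
      (S.indicator fun _ => (K : ℝ≥0∞) ^ (m : ℝ≥0∞).toReal) ?_ ?_ ?_ ?_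
    · exact fun n => ((measurable_fderiv ℝ (G n)).enorm).pow_const _
    · refine fun n => ae_of_all _ fun x => ?_
      by_cases hx : x ∈ S
      · simp only [Set.indicator_of_mem hx]
        gcongr
        rw [← ofReal_norm, ENNReal.ofReal_le_iff_le_toReal (by simp)]
        exact hGb n x
      · have : fderiv ℝ (G n) x = 0 := by
          by_contra h
          exact hx ((closure_minimal (hGs n) hSc.isClosed) (support_fderiv_subset ℝ h))
        simp only [this]
        rw [← ofReal_norm, norm_zero, ENNReal.ofReal_zero, ENNReal.zero_rpow_of_pos]
        · exact zero_le
        · simp; omega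
    · rw [lintegral_indicator hSc.measurableSet, setLIntegral_const]
      exact ENNReal.mul_ne_top (ENNReal.rpow_ne_top_of_nonneg (by positivity) (by simp))
        hSc.measure_lt_top.ne
    · filter_upwards [hlim] with x hx
      exact ((ENNReal.continuous_rpow_const).tendsto _).comp hx.enorm
  calc eLpNorm g r volume ≤ atTop.liminf fun n => eLpNorm (G n) r volume :=
        Lp.eLpNorm_lim_le_liminf_eLpNorm (fun n => (hGC n).continuous.aestronglyMeasurable) g
          (ae_of_all _ fun x =>
            ContDiffBump.convolution_tendsto_right_of_continuous hφ0 hg.continuous x)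
    _ ≤ atTop.liminf fun n => C * eLpNorm (fderiv ℝ (G n)) m volume :=
        liminf_le_liminf (Eventually.of_forall fun n => H _ (hGC n) (hGs n))
    _ = C * eLpNorm (fderiv ℝ g) m volume :=
        (ENNReal.Tendsto.const_mul hT (Or.inr hC)).liminf_eq

theorem unif_bound {m : ℕ} (hm : 1 ≤ m) {s : Set (EuclideanSpace ℝ (Fin m))}
    (hs : IsCompact s)
    (g : ℕ → EuclideanSpace ℝ (Fin m) → ℝ)
    (hlip : ∀ k, ∃ K : NNReal, LipschitzWith K (g k))
    (hDgequi : EquiIntegrableSeq volume (fun k x => ‖fderiv ℝ (g k) x‖ ^ (m : ℝ))) :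
    ∃ M : ℝ≥0∞, M ≠ ⊤ ∧ ∀ k, ∫⁻ x in s, ‖fderiv ℝ (g k) x‖ₑ ^ (m : ℝ) ≤ M := by
  have : NeZero m := ⟨by omega⟩
  obtain ⟨δ, hδ, H⟩ := hDgequi 1 one_pos
  refine hs.induction_on (p := fun s => ∃ M : ℝ≥0∞, M ≠ ⊤ ∧
    ∀ k, ∫⁻ x in s, ‖fderiv ℝ (g k) x‖ₑ ^ (m : ℝ) ≤ M) ⟨0, by simp, by simp⟩ ?_ ?_ ?_
  · rintro a b hab ⟨M, hM, h⟩
    exact ⟨M, hM, fun k => (lintegral_mono_set hab).trans (h k)⟩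
  · rintro a b ⟨M, hM, h⟩ ⟨M', hM', h'⟩
    exact ⟨M + M', ENNReal.add_ne_top.2 ⟨hM, hM'⟩, fun k =>
      (lintegral_union_le _ _ _).trans (add_le_add (h k) (h' k))⟩
  · intro x _
    obtain ⟨U, hxU, hU, hUδ⟩ := Set.exists_isOpen_lt_of_lt {x} (ENNReal.ofReal δ)
      (μ := (volume : Measure (EuclideanSpace ℝ (Fin m)))) (by simpa using hδ)
    refine ⟨U, mem_nhdsWithin_of_mem_nhds (hU.mem_nhds (hxU rfl)), 1, by simp, fun k => ?_⟩
    have h1 := H U hU.measurableSet hUδ.le k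
    obtain ⟨K, hK⟩ := hlip k
    have hint : Integrable (fun x => |‖fderiv ℝ (g k) x‖ ^ (m : ℝ)|) (volume.restrict U) := by
      refine Measure.integrableOn_of_bounded (M := (K : ℝ) ^ (m : ℝ)) (hUδ.trans ENNReal.ofReal_lt_top).ne
        ?_ (ae_of_all _ fun x => ?_)
      · exact ((measurable_fderiv ℝ (g k)).norm.pow_const _).abs.aestronglyMeasurable
      · rw [Real.norm_eq_abs, abs_abs, abs_of_nonneg (by positivity)]
        gcongr
        exact norm_fderiv_le_of_lipschitz ℝ hK
    have h2 := ofReal_integral_eq_lintegral_ofReal hint (ae_of_all _ fun x => abs_nonneg _)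
    have h3 : ∀ x, ENNReal.ofReal |‖fderiv ℝ (g k) x‖ ^ (m : ℝ)| = ‖fderiv ℝ (g k) x‖ₑ ^ (m : ℝ) := by
      intro x
      rw [abs_of_nonneg (by positivity), ← ENNReal.ofReal_rpow_of_nonneg (by positivity) (by positivity),
        ofReal_norm]
    simp only [h3] at h2
    rw [← h2]
    simpa using h1

/-- Let `m ≥ 1` and `Ω ⊆ ℝ^m` bounded and measurable. Let `(g_k)` be Lipschitz functions
with compact support contained in `Ω` such that `(|g_k|^m)` and `(|Dg_k|^m)` are
equi-integrable for Lebesgue measure. Then, for every `q ∈ [1, ∞)`, the sequence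
`(|g_k|^q)` is equi-integrable. -/
theorem equiintegrable_all_powers_of_equiintegrable_critical
    {m : ℕ} (hm : 1 ≤ m)
    (Ω : Set (EuclideanSpace ℝ (Fin m))) (hΩbd : Bornology.IsBounded Ω)
    (hΩmeas : MeasurableSet Ω)
    (g : ℕ → EuclideanSpace ℝ (Fin m) → ℝ)
    (hlip : ∀ k, ∃ K : NNReal, LipschitzWith K (g k))
    (hsupp : ∀ k, HasCompactSupport (g k) ∧ tsupport (g k) ⊆ Ω)
    (hgequi : EquiIntegrableSeq volume (fun k x => |g k x| ^ (m : ℝ)))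
    (hDgequi : EquiIntegrableSeq volume (fun k x => ‖fderiv ℝ (g k) x‖ ^ (m : ℝ))) :
    ∀ q : ℝ, 1 ≤ q → EquiIntegrableSeq volume (fun k x => |g k x| ^ q) := by
  intro q hq
  obtain ⟨M, hM, hMb⟩ := unif_bound hm hΩbd.isCompact_closure g hlip hDgequi
  let r : ℝ≥0 := ⟨2 * q, by linarith⟩
  have hrq : (r : ℝ) = 2 * q := rfl
  have hr2 : 2 ≤ r := by
    rw [← NNReal.coe_le_coe, hrq]; push_cast; linarith
  have hr0 : r ≠ 0 := (lt_of_lt_of_le two_pos hr2).ne'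
  obtain ⟨C, hC, hCb⟩ := sob_lip hm hΩbd r hr2
  have hm0 : (m : ℝ≥0∞) ≠ 0 := by exact_mod_cast (by omega : m ≠ 0)
  have hcont : ∀ k, Continuous (g k) := fun k => (hlip k).choose_spec.continuous
  -- uniform bound on the `2q` power
  obtain ⟨B, hB0, hB⟩ : ∃ B : ℝ, 0 ≤ B ∧ ∀ k, ∫ x, |g k x| ^ (2 * q) ≤ B := by
    have hfin : (C * M ^ (1 / (m : ℝ))) ^ (r : ℝ) ≠ ⊤ :=
      ENNReal.rpow_ne_top_of_nonneg (by positivity)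
        (ENNReal.mul_ne_top hC (ENNReal.rpow_ne_top_of_nonneg (by positivity) hM))
    refine ⟨((C * M ^ (1 / (m : ℝ))) ^ (r : ℝ)).toReal, by positivity, fun k => ?_⟩
    obtain ⟨K, hK⟩ := hlip k
    have h1 := hCb (g k) K hK ((subset_tsupport _).trans (hsupp k).2)
    have h2 : eLpNorm (fderiv ℝ (g k)) m volume ≤ M ^ (1 / (m : ℝ)) := by
      rw [eLpNorm_eq_lintegral_rpow_enorm_toReal hm0 (by simp)]
      simp only [ENNReal.toReal_natCast]
      gcongr
      refine le_trans (le_of_eq ?_) (hMb k)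
      refine (setLIntegral_eq_of_support_subset ?_).symm
      intro x hx
      have hx' : fderiv ℝ (g k) x ≠ 0 := by
        rintro h
        apply hx
        have : (0 : ℝ) < m := by exact_mod_cast hm
        simp only [h]
        rw [← ofReal_norm, norm_zero, ENNReal.ofReal_zero, ENNReal.zero_rpow_of_pos this]
      exact subset_closure ((hsupp k).2 (support_fderiv_subset ℝ hx'))
    have h3 : ∫⁻ x, ‖g k x‖ₑ ^ (r : ℝ) ≤ (C * M ^ (1 / (m : ℝ))) ^ (r : ℝ) := by
      rw [← eLpNorm_nnreal_pow_eq_lintegral hr0]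
      gcongr
      exact h1.trans (by gcongr)
    rw [integral_eq_lintegral_of_nonneg_ae (ae_of_all _ fun x => by positivity)
      ((hcont k).abs.measurable.pow_const _).aestronglyMeasurable]
    refine ENNReal.toReal_mono hfin (le_trans (le_of_eq (lintegral_congr fun x => ?_)) h3)
    rw [← ENNReal.ofReal_rpow_of_nonneg (by positivity) (by linarith), ← Real.norm_eq_abs,
      ofReal_norm, hrq]
  have hint : ∀ (k : ℕ) (p : ℝ), 0 < p → Integrable (fun x => |g k x| ^ p) := by
    intro k p hp
    refine Continuous.integrable_of_hasCompactSupport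
      ((hcont k).abs.rpow_const fun x => Or.inr hp.le) ?_
    exact (hsupp k).1.comp_left (g := fun y : ℝ => |y| ^ p) (by simp [hp.ne'])
  intro ε hε
  set η := ε / (2 * (B + 1)) with hη
  have hηpos : 0 < η := by positivity
  refine ⟨η * ε / 2, by positivity, fun E hE hEδ k => ?_⟩
  have hEfin : volume E ≠ ⊤ := (hEδ.trans_lt ENNReal.ofReal_lt_top).ne
  have hpt : ∀ x, |(|g k x| ^ q)| ≤ η * |g k x| ^ (2 * q) + η⁻¹ := by
    intro x
    have ht : 0 ≤ |g k x| ^ q := by positivity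
    rw [abs_of_nonneg ht, mul_comm 2 q, Real.rpow_mul (abs_nonneg _)]
    set t := |g k x| ^ q
    rw [Real.rpow_two]
    have h1 : η * η⁻¹ = 1 := mul_inv_cancel₀ hηpos.ne'
    have h2 : η * t ^ 2 + η⁻¹ - t = η * (t - η⁻¹ / 2) ^ 2 + 3 / 4 * η⁻¹ := by
      field_simp; ring
    have : 0 ≤ η * (t - η⁻¹ / 2) ^ 2 + 3 / 4 * η⁻¹ := by positivity
    linarith
  have hI2 : Integrable (fun x => η * |g k x| ^ (2 * q)) := (hint k _ (by linarith)).const_mul η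
  have hIc : IntegrableOn (fun _ => η⁻¹) E (volume : Measure (EuclideanSpace ℝ (Fin m))) := 
    integrableOn_const hEfin
  have hvol : (volume E).toReal ≤ η * ε / 2 := ENNReal.toReal_le_of_le_ofReal (by positivity) hEδ
  calc ∫ x in E, |(|g k x| ^ q)| ≤ ∫ x in E, (η * |g k x| ^ (2 * q) + η⁻¹) :=
        integral_mono (hint k q (by linarith)).abs.integrableOn (hI2.integrableOn.add hIc) hpt
    _ = (∫ x in E, η * |g k x| ^ (2 * q)) + ∫ x in E, η⁻¹ := integral_add hI2.integrableOn hIc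
    _ ≤ (∫ x, η * |g k x| ^ (2 * q)) + (volume E).toReal * η⁻¹ := by
        refine add_le_add (setIntegral_le_integral hI2 (ae_of_all _ fun x => by positivity)) ?_
        simp [Measure.real]
    _ ≤ η * B + (η * ε / 2) * η⁻¹ := by
        rw [integral_const_mul]
        gcongr
        exact hB k
    _ ≤ ε := by
        have h1 : η * ε / 2 * η⁻¹ = ε / 2 := by field_simp
        have h2 : η * B ≤ ε / 2 := by
          rw [hη, div_mul_eq_mul_div, div_le_iff₀ (by positivity)]
          nlinarith
        linarith
end

section
/- Sobolev bound for truncations: Let m ≥ 2 and p ∈ [1, m), and set p* := mp/(m−p). There exists a constant C, depending only on m and p, with the following property: for every Lipschitz function g : ℝ^m → ℝ with compact support and every t ≥ 0, the truncated tail g^t := g − max(−t, min(g, t)) satisfies ( ∫_{ℝ^m} |g^t|^{p*} dx )^{p/p*} ≤ C ∫_{{x : |g(x)| > t}} |Dg(x)|^p dx, where Dg denotes the derivative of g, defined Lebesgue-almost everywhere by Rademacher's theorem. -/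
open MeasureTheory

open Filter Topology ContinuousLinearMap in
open scoped Convolution in
theorem aux_hasFDerivAt {m : ℕ} {f : EuclideanSpace ℝ (Fin m) → ℝ} {K : NNReal}
    (hf : LipschitzWith K f) (hc : HasCompactSupport f)
    (φ : ContDiffBump (0 : EuclideanSpace ℝ (Fin m))) (x : EuclideanSpace ℝ (Fin m)) :
    HasFDerivAt (φ.normed volume ⋆[lsmul ℝ ℝ, volume] f)
      ((φ.normed volume ⋆[lsmul ℝ ℝ, volume] (fderiv ℝ f)) x) x := by
  have hq := quasiMeasurePreserving_sub_left_of_right_invariant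
    (volume : Measure (EuclideanSpace ℝ (Fin m))) x
  refine (hasFDerivAt_integral_of_dominated_loc_of_lip (s := Set.univ)
    (F := fun x t => lsmul ℝ ℝ (φ.normed volume t) (f (x - t)))
    (F' := fun t => lsmul ℝ ℝ (φ.normed volume t) (fderiv ℝ f (x - t)))
    (bound := fun t => φ.normed volume t * K) Filter.univ_mem ?_ ?_ ?_ ?_ ?_ ?_).2
  · refine Eventually.of_forall fun y => Continuous.aestronglyMeasurable ?_
    have := hf.continuous
    have := φ.continuous_normed (μ := volume)
    simp only [lsmul_apply]
    fun_prop
  · have h1 := hf.continuous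
    have h2 := φ.continuous_normed (μ := volume)
    refine Continuous.integrable_of_hasCompactSupport ?_ ?_
    · simp only [lsmul_apply]
      fun_prop
    · simp only [lsmul_apply]
      exact (φ.hasCompactSupport_normed (μ := volume)).smul_right
  · simp only [lsmul_apply]
    have h2 := φ.continuous_normed (μ := volume)
    have h3 : Measurable (fun t => fderiv ℝ f (x - t)) :=
      (measurable_fderiv ℝ f).comp (measurable_const.sub measurable_id)
    exact (h2.measurable.smul h3).aestronglyMeasurable
  · refine Eventually.of_forall fun t => ?_
    rw [lipschitzOnWith_univ]
    refine LipschitzWith.of_dist_le_mul fun a b => ?_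
    have h0 := φ.nonneg_normed (μ := volume) t
    have h := hf.dist_le_mul (a - t) (b - t)
    rw [dist_sub_right] at h
    simp only [lsmul_apply, smul_eq_mul, Real.dist_eq, ← mul_sub, abs_mul, abs_of_nonneg h0,
      Real.coe_nnabs, NNReal.abs_eq] at h ⊢
    rw [mul_assoc]
    gcongr
  · exact φ.integrable_normed.mul_const _
  · have := hq.ae (hf.ae_differentiableAt (μ := volume))
    filter_upwards [this] with t ht
    have h1 : HasFDerivAt (fun y => f (y - t)) (fderiv ℝ f (x - t)) x := by
      simpa [Function.comp_def] using
        HasFDerivAt.comp x (f := fun y => y - t) ht.hasFDerivAt ((hasFDerivAt_id x).sub_const t)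
    exact h1.const_smul (φ.normed volume t)

open Filter Topology ContinuousLinearMap in
open scoped Convolution in
theorem aux_sobolev {m : ℕ} (hm : 2 ≤ m) {p p' : NNReal} (hp : 1 ≤ p)
    (hp' : (p' : ℝ)⁻¹ = p⁻¹ - (m : ℝ)⁻¹)
    {f : EuclideanSpace ℝ (Fin m) → ℝ} {K : NNReal}
    (hf : LipschitzWith K f) (hc : HasCompactSupport f) :
    eLpNorm f p' volume ≤
      eLpNormLESNormFDerivOfEqInnerConst (volume : Measure (EuclideanSpace ℝ (Fin m))) p
        * eLpNorm (fderiv ℝ f) p volume := by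
  have hp0 : (p : ℝ) ≠ 0 := by
    have : 0 < p := lt_of_lt_of_le one_pos hp
    exact_mod_cast this.ne'
  have hpp : (0 : ℝ) < p := lt_of_le_of_ne p.2 (Ne.symm hp0)
  let φ : ℕ → ContDiffBump (0 : EuclideanSpace ℝ (Fin m)) := fun n =>
    ⟨1 / 2 * (1 / ((n : ℝ) + 1)), 1 / ((n : ℝ) + 1), by positivity, by
      have : 0 < 1 / ((n : ℝ) + 1) := by positivity
      linarith⟩
  have hφ : Tendsto (fun n => (φ n).rOut) atTop (𝓝 0) := tendsto_one_div_add_atTop_nhds_zero_nat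
  have hφ2 : ∀ᶠ n in atTop, (φ n).rOut ≤ 2 * (φ n).rIn :=
    Eventually.of_forall fun n => by simp only [φ]; linarith
  have hφ1 : ∀ n, (φ n).rOut ≤ 1 := fun n => by
    simp only [φ]
    rw [div_le_one (by positivity)]
    linarith [(Nat.cast_nonneg n : (0:ℝ) ≤ n)]
  have hbd : ∀ x, ‖fderiv ℝ f x‖ ≤ K := fun x => norm_fderiv_le_of_lipschitz ℝ hf
  obtain ⟨R, hR⟩ := hc.isBounded.subset_closedBall 0
  have hz : ∀ x, R < ‖x‖ → fderiv ℝ f x = 0 := fun x hx => by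
    by_contra h
    have := hR (support_fderiv_subset ℝ (f := f) h)
    simp at this
    linarith
  have hli : LocallyIntegrable (fderiv ℝ f) volume := by
    intro x
    refine ⟨Metric.ball x 1, Metric.ball_mem_nhds _ one_pos, ?_⟩
    refine Measure.integrableOn_of_bounded (M := K) measure_ball_lt_top.ne
      (measurable_fderiv ℝ f).aestronglyMeasurable (Eventually.of_forall hbd)
  let u : ℕ → EuclideanSpace ℝ (Fin m) → ℝ := fun n => (φ n).normed volume ⋆[lsmul ℝ ℝ, volume] f
  have hu1 : ∀ n, ContDiff ℝ 1 (u n) := fun n =>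
    ((φ n).hasCompactSupport_normed).contDiff_convolution_left (n := 1) _ (φ n).contDiff_normed
      hf.continuous.locallyIntegrable
  have hu2 : ∀ n, HasCompactSupport (u n) := fun n =>
    ((φ n).hasCompactSupport_normed).convolution _ hc
  have hud : ∀ n x, fderiv ℝ (u n) x = ∫ t, (φ n).normed volume t • fderiv ℝ f (x - t) :=
    fun n x => (aux_hasFDerivAt hf hc (φ n) x).fderiv
  have hubd : ∀ n x, ‖fderiv ℝ (u n) x‖ ≤ K := fun n x => by
    rw [hud]
    have := norm_integral_le_of_norm_le (μ := volume)
      (f := fun t => (φ n).normed volume t • fderiv ℝ f (x - t))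
      (g := fun t => (φ n).normed volume t * K) ((φ n).integrable_normed.mul_const _)
      (Eventually.of_forall fun t => by
        have h0 := (φ n).nonneg_normed (μ := volume) t
        rw [norm_smul, Real.norm_of_nonneg h0]
        gcongr
        exact hbd _)
    rwa [integral_mul_const, (φ n).integral_normed, one_mul] at this
  have huz : ∀ n x, R + 1 < ‖x‖ → fderiv ℝ (u n) x = 0 := fun n x hx => by
    rw [hud, ← integral_zero (EuclideanSpace ℝ (Fin m)) (EuclideanSpace ℝ (Fin m) →L[ℝ] ℝ)]
    congr 1
    ext1 t
    by_cases ht : (φ n).normed volume t = 0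
    · simp [ht]
    · have h1 : t ∈ Function.support ((φ n).normed volume) := ht
      rw [(φ n).support_normed_eq] at h1
      simp at h1
      rw [hz, smul_zero]
      have := norm_sub_norm_le x t
      linarith [hφ1 n]
  have hlim : Tendsto (fun n => ∫⁻ x, ‖fderiv ℝ (u n) x‖ₑ ^ (p : ℝ)) atTop
      (𝓝 (∫⁻ x, ‖fderiv ℝ f x‖ₑ ^ (p : ℝ))) := by
    refine tendsto_lintegral_of_dominated_convergence
      ((Metric.closedBall 0 (R + 1)).indicator fun _ => (K : ENNReal) ^ (p : ℝ)) ?_ ?_ ?_ ?_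
    · intro n
      exact (measurable_fderiv ℝ (u n)).enorm.pow_const _
    · intro n
      refine Eventually.of_forall fun x => ?_
      by_cases hx : x ∈ Metric.closedBall (0 : EuclideanSpace ℝ (Fin m)) (R + 1)
      · rw [Set.indicator_of_mem hx]
        have : ‖fderiv ℝ (u n) x‖ₑ ≤ K := by
          rw [enorm_eq_nnnorm]
          exact_mod_cast hubd n x
        exact ENNReal.rpow_le_rpow this p.2
      · beta_reduce
        rw [Set.indicator_of_notMem hx, huz n x (by simpa using hx)]
        exact le_of_eq (by rw [enorm_eq_nnnorm, nnnorm_zero, ENNReal.coe_zero, ENNReal.zero_rpow_of_pos hpp])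
    · rw [lintegral_indicator Metric.isClosed_closedBall.measurableSet, lintegral_const]
      refine ENNReal.mul_ne_top (ENNReal.rpow_ne_top_of_nonneg p.2 ENNReal.coe_ne_top) ?_
      simpa using (measure_closedBall_lt_top).ne
    · filter_upwards [ContDiffBump.ae_convolution_tendsto_right_of_locallyIntegrable hφ hφ2 hli]
        with x hx
      have : Tendsto (fun n => fderiv ℝ (u n) x) atTop (𝓝 (fderiv ℝ f x)) :=
        hx.congr fun n => (aux_hasFDerivAt hf hc (φ n) x).fderiv.symm
      exact (ENNReal.continuous_rpow_const.tendsto _).comp this.enorm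
  have hpe0 : (p : ENNReal) ≠ 0 := by
    have : p ≠ 0 := by exact_mod_cast hp0
    exact_mod_cast this
  have hlim2 : Tendsto (fun n => eLpNorm (fderiv ℝ (u n)) p volume) atTop
      (𝓝 (eLpNorm (fderiv ℝ f) p volume)) := by
    simp only [eLpNorm_eq_lintegral_rpow_enorm_toReal hpe0 ENNReal.coe_ne_top, ENNReal.coe_toReal]
    exact (ENNReal.continuous_rpow_const.tendsto _).comp hlim
  have hlim3 := ENNReal.Tendsto.const_mul (a := (eLpNormLESNormFDerivOfEqInnerConst
    (volume : Measure (EuclideanSpace ℝ (Fin m))) p : ENNReal)) hlim2 (Or.inr ENNReal.coe_ne_top)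
  refine (Lp.eLpNorm_lim_le_liminf_eLpNorm (f := u)
    (fun n => (hu1 n).continuous.aestronglyMeasurable) f
    (Eventually.of_forall fun x =>
      ContDiffBump.convolution_tendsto_right_of_continuous hφ hf.continuous x)).trans ?_
  rw [← hlim3.liminf_eq]
  refine liminf_le_liminf (Eventually.of_forall fun n => ?_)
  refine eLpNorm_le_eLpNorm_fderiv_of_eq_inner volume (hu1 n) (hu2 n) hp ?_ ?_
  · simp; omega
  · simpa using hp'

/-- At almost every zero of a Lipschitz function the derivative vanishes. -/
theorem aux_fderiv_zero {m : ℕ} {f : EuclideanSpace ℝ (Fin m) → ℝ} {K : NNReal}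
    (hf : LipschitzWith K f) : ∀ᵐ x, f x = 0 → fderiv ℝ f x = 0 := by
  have h1 : LipschitzWith K (fun x => max (f x) 0) := hf.max_const 0
  have h2 : LipschitzWith K (fun x => max (- f x) 0) := hf.neg.max_const 0
  filter_upwards [h1.ae_differentiableAt (μ := volume), h2.ae_differentiableAt (μ := volume)]
    with x d1 d2 hx
  have e1 : fderiv ℝ (fun x => max (f x) 0) x = 0 :=
    IsLocalMin.fderiv_eq_zero (Filter.Eventually.of_forall fun y => by simp [hx])
  have e2 : fderiv ℝ (fun x => max (- f x) 0) x = 0 :=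
    IsLocalMin.fderiv_eq_zero (Filter.Eventually.of_forall fun y => by simp [hx])
  have e : f = fun x => max (f x) 0 - max (- f x) 0 := by
    ext y
    rcases le_total 0 (f y) with h | h <;> simp [h]
  rw [e, fderiv_fun_sub d1 d2, e1, e2, sub_zero]

open Filter Topology in
theorem aux_trunc {m : ℕ} {g : EuclideanSpace ℝ (Fin m) → ℝ} {K : NNReal}
    (hg : LipschitzWith K g) (hc : HasCompactSupport g) {t : ℝ} (ht : 0 ≤ t) :
    ∃ K' : NNReal, LipschitzWith K' (fun x => g x - max (-t) (min (g x) t)) ∧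
      HasCompactSupport (fun x => g x - max (-t) (min (g x) t)) ∧
      ∀ᵐ x, fderiv ℝ (fun x => g x - max (-t) (min (g x) t)) x =
        ({x | t < |g x|}).indicator (fderiv ℝ g) x := by
  have hL : LipschitzWith (K + K) (fun x => g x - max (-t) (min (g x) t)) :=
    hg.sub ((hg.min_const t).const_max (-t))
  refine ⟨K + K, hL, ?_, ?_⟩
  · exact hc.comp_left (g := fun y => y - max (-t) (min y t)) (by simp [ht])
  · filter_upwards [aux_fderiv_zero hL] with x hx
    by_cases h : t < |g x|
    · rw [Set.indicator_of_mem (by exact h)]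
      rcases lt_abs.1 h with h | h
      · have : (fun x => g x - max (-t) (min (g x) t)) =ᶠ[𝓝 x] fun x => g x - t := by
          filter_upwards [hg.continuous.continuousAt.eventually_mem (lt_mem_nhds h)] with y hy
          rw [min_eq_right hy.le, max_eq_right (by linarith)]
        rw [this.fderiv_eq, fderiv_sub_const]
      · have : (fun x => g x - max (-t) (min (g x) t)) =ᶠ[𝓝 x] fun x => g x - (-t) := by
          filter_upwards [hg.continuous.continuousAt.eventually_mem
            (gt_mem_nhds (show g x < -t by linarith))] with y hy
          have hy' : g y < -t := hy
          rw [min_eq_left (by linarith), max_eq_left (by linarith)]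
        rw [this.fderiv_eq, fderiv_sub_const]
    · rw [Set.indicator_of_notMem (by exact h)]
      apply hx
      have h' := abs_le.1 (not_lt.1 h)
      rw [min_eq_left h'.2, max_eq_right h'.1, sub_self]

/-- **Sobolev bound for truncations.** Let `m ≥ 2`, `p ∈ [1, m)` and
`p* = mp/(m−p)`. There is a constant `C = C(m,p)` such that for every Lipschitz
`g : ℝ^m → ℝ` with compact support and every `t ≥ 0`, the truncated tail
`g^t := g − max (−t) (min g t)` satisfies
`(∫ |g^t|^{p*})^{p/p*} ≤ C ∫_{{|g| > t}} |Dg|^p`. -/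
theorem sobolev_bound_for_truncations
    (m : ℕ) (hm : 2 ≤ m) (p : ℝ) (hp1 : 1 ≤ p) (hpm : p < m) :
    ∃ C : ℝ, 0 < C ∧
      ∀ (g : EuclideanSpace ℝ (Fin m) → ℝ) (K : NNReal), LipschitzWith K g →
        HasCompactSupport g → ∀ t : ℝ, 0 ≤ t →
        (∫ x, |g x - max (-t) (min (g x) t)| ^ (m * p / (m - p))) ^ (p / (m * p / (m - p)))
          ≤ C * ∫ x in {x | t < |g x|}, ‖fderiv ℝ g x‖ ^ p := by
  have hp0 : 0 < p := by linarith
  have hmp : 0 < (m : ℝ) - p := by linarith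
  have hm0 : 0 < (m : ℝ) := by linarith
  have hq0 : 0 < m * p / (m - p) := by positivity
  have hqi : (m * p / (m - p))⁻¹ = p⁻¹ - (m : ℝ)⁻¹ := by field_simp
  generalize m * p / (m - p) = q at hq0 hqi ⊢
  lift p to NNReal using hp0.le
  lift q to NNReal using hq0.le
  set c := eLpNormLESNormFDerivOfEqInnerConst (volume : Measure (EuclideanSpace ℝ (Fin m))) p
  refine ⟨(c : ℝ) ^ (p : ℝ) + 1, by positivity, fun g K hg hc t ht => ?_⟩
  obtain ⟨K', hL, hcs, hae⟩ := aux_trunc hg hc ht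
  have hS := aux_sobolev hm (by exact_mod_cast hp1) hqi hL hcs
  set f : EuclideanSpace ℝ (Fin m) → ℝ := fun x => g x - max (-t) (min (g x) t) with hfdef
  change (∫ x, |f x| ^ (q : ℝ)) ^ ((p : ℝ) / q) ≤ _
  have hpe : (p : ENNReal) ≠ 0 := by
    have : p ≠ 0 := by exact_mod_cast hp0.ne'
    exact_mod_cast this
  have hqe : (q : ENNReal) ≠ 0 := by
    have : q ≠ 0 := by exact_mod_cast hq0.ne'
    exact_mod_cast this
  have hM1 : MemLp f q volume := hL.continuous.memLp_of_hasCompactSupport hcs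
  have hM2 : MemLp (fderiv ℝ f) p volume :=
    (hcs.fderiv ℝ).memLp_of_bound (measurable_fderiv ℝ f).aestronglyMeasurable K'
      (Filter.Eventually.of_forall fun x => norm_fderiv_le_of_lipschitz ℝ hL)
  have hR : ∫ x in {x | t < |g x|}, ‖fderiv ℝ g x‖ ^ (p : ℝ) = ∫ x, ‖fderiv ℝ f x‖ ^ (p : ℝ) := by
    have hopen : IsOpen {x | t < |g x|} := isOpen_lt continuous_const hg.continuous.abs
    rw [← integral_indicator hopen.measurableSet]
    refine integral_congr_ae ?_
    filter_upwards [hae] with x hx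
    rw [hx]
    by_cases h : x ∈ {x | t < |g x|}
    · simp only [Set.indicator_of_mem h]
    · simp only [Set.indicator_of_notMem h, norm_zero, Real.zero_rpow hp0.ne']
  rw [hR]
  rw [hM1.eLpNorm_eq_integral_rpow_norm hqe ENNReal.coe_ne_top,
    hM2.eLpNorm_eq_integral_rpow_norm hpe ENNReal.coe_ne_top, ENNReal.coe_toReal,
    ENNReal.coe_toReal, ← ENNReal.ofReal_coe_nnreal, ← ENNReal.ofReal_mul (NNReal.coe_nonneg _)] at hS
  have hI1 : 0 ≤ ∫ x, |f x| ^ (q : ℝ) := integral_nonneg fun x => by positivity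
  have hI2 : 0 ≤ ∫ x, ‖fderiv ℝ f x‖ ^ (p : ℝ) := integral_nonneg fun x => by positivity
  rw [ENNReal.ofReal_le_ofReal_iff (by positivity)] at hS
  simp only [Real.norm_eq_abs] at hS
  have hS2 := Real.rpow_le_rpow (by positivity) hS hp0.le
  rw [Real.mul_rpow (NNReal.coe_nonneg _) (by positivity), ← Real.rpow_mul hI1,
    ← Real.rpow_mul hI2, inv_mul_cancel₀ hp0.ne', Real.rpow_one] at hS2
  rw [div_eq_inv_mul]
  refine hS2.trans ?_
  rw [add_mul, one_mul]
  exact le_add_of_nonneg_right hI2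
end
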